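/- Let μ be a probability measure on ℝⁿ with finite first moment and zero barycenter. If (ρ_k) is a sequence in P_1(ℝⁿ) with ∫ x dρ_k(x) = 0 for every k, converging weakly to a probability measure ρ, then T(ρ,μ) ≤ liminf_{k→∞} T(ρ_k,μ). -/

import Mathlib

open MeasureTheory Topology Filter Set
open scoped ENNReal RealInnerProductSpace

noncomputable section

abbrev En (n : ℕ) : Type := EuclideanSpace ℝ (Fin n)

/-- The positive part of an extended real number, as an element of `ℝ≥0∞`. -/
def posPartNN (x : EReal) : ℝ≥0∞ := if x = ⊤ then ⊤ else ENNReal.ofReal x.toReal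

/-- The integral of an `EReal`-valued function, with values in `EReal`
(defined as the integral of the positive part minus that of the negative part). -/
def eInt {X : Type*} [MeasurableSpace X] (ρ : Measure X) (g : X → EReal) : EReal :=
  ((∫⁻ x, posPartNN (g x) ∂ρ : ℝ≥0∞) : EReal) - ((∫⁻ x, posPartNN (-(g x)) ∂ρ : ℝ≥0∞) : EReal)

/-- Transport plans between `ρ` and `μ`. -/
def Plans {n : ℕ} (ρ μ : Measure (En n)) : Set (Measure (En n × En n)) :=
  {γ | IsProbabilityMeasure γ ∧ γ.map Prod.fst = ρ ∧ γ.map Prod.snd = μ}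

/-- The maximal correlation functional `T(ρ,μ)`. -/
def Tcorr {n : ℕ} (ρ μ : Measure (En n)) : EReal :=
  ⨆ γ ∈ Plans ρ μ, eInt γ (fun p => ((⟪p.1, p.2⟫ : ℝ) : EReal))

/-- The local functional `F(ρ) = ∫ f(ρ^ac) dx` with `f(t) = -t^α/α`, `α = 1 - 1/(n+q)`. -/
def Ffun (n : ℕ) (q : ℝ) (ρ : Measure (En n)) : EReal :=
  - ((∫⁻ x, ENNReal.ofReal
      ((ρ.rnDeriv volume x).toReal ^ (1 - 1/((n : ℝ) + q)) / (1 - 1/((n : ℝ) + q)))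
      ∂volume : ℝ≥0∞) : EReal)

/-- The functional `J(ρ) = F(ρ) + T(ρ,μ)`. -/
def Jfun (n : ℕ) (q : ℝ) (μ ρ : Measure (En n)) : EReal := Ffun n q ρ + Tcorr ρ μ

/-- Finite first moment. -/
def P1 {n : ℕ} (ρ : Measure (En n)) : Prop := Integrable (fun x : En n => ‖x‖) ρ

/-- `μ` is not supported on any affine hyperplane. -/
def NotHyperplane {n : ℕ} (μ : Measure (En n)) : Prop :=
  ∀ (e : En n) (ℓ : ℝ), e ≠ 0 → μ {x | ⟪x, e⟫ = ℓ} ≠ 1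

lemma posPartNN_coe (r : ℝ) : posPartNN (r : EReal) = ENNReal.ofReal r := by
  simp [posPartNN]

lemma eInt_coe {X : Type*} [MeasurableSpace X] {ρ : Measure X} (f : X → ℝ) :
    eInt ρ (fun x => (f x : EReal)) =
      ((∫⁻ x, ENNReal.ofReal (f x) ∂ρ : ℝ≥0∞) : EReal)
        - ((∫⁻ x, ENNReal.ofReal (-f x) ∂ρ : ℝ≥0∞) : EReal) := by
  simp only [eInt, posPartNN_coe, ← EReal.coe_neg]

lemma coe_integral_eq_lintegral_sub {X : Type*} [MeasurableSpace X] {ρ : Measure X} {f : X → ℝ}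
    (hf : Integrable f ρ) :
    ((∫ x, f x ∂ρ : ℝ) : EReal) = ((∫⁻ x, ENNReal.ofReal (f x) ∂ρ : ℝ≥0∞) : EReal)
        - ((∫⁻ x, ENNReal.ofReal (-f x) ∂ρ : ℝ≥0∞) : EReal) := by
  have h1 : ∫⁻ x, ENNReal.ofReal (f x) ∂ρ ≠ ⊤ := hf.lintegral_lt_top.ne
  have h2 : ∫⁻ x, ENNReal.ofReal (-f x) ∂ρ ≠ ⊤ := hf.neg.lintegral_lt_top.ne
  rw [integral_eq_lintegral_pos_part_sub_lintegral_neg_part hf, EReal.coe_sub,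
    EReal.coe_ennreal_toReal h1, EReal.coe_ennreal_toReal h2]

lemma eInt_coe_of_integrable {X : Type*} [MeasurableSpace X] {ρ : Measure X} {f : X → ℝ}
    (hf : Integrable f ρ) : eInt ρ (fun x => (f x : EReal)) = ((∫ x, f x ∂ρ : ℝ) : EReal) := by
  rw [eInt_coe, coe_integral_eq_lintegral_sub hf]

lemma P1.integrable_id {n : ℕ} {ρ : Measure (En n)} (h : P1 ρ) : Integrable (fun x => x) ρ :=
  (integrable_norm_iff aestronglyMeasurable_id).1 h

/-- A density `D` with respect to `ρ ⊗ μ` whose partial integrals are all equal to `1` defines a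
transport plan. -/
lemma withDensity_mem_Plans {n : ℕ} {ρ μ : Measure (En n)} [IsProbabilityMeasure ρ]
    [IsProbabilityMeasure μ] {D : En n × En n → ℝ≥0∞} (hD : Measurable D)
    (h1 : ∀ x, ∫⁻ y, D (x, y) ∂μ = 1) (h2 : ∀ y, ∫⁻ x, D (x, y) ∂ρ = 1) :
    (ρ.prod μ).withDensity D ∈ Plans ρ μ := by
  have hfst : ((ρ.prod μ).withDensity D).map Prod.fst = ρ := by
    ext s hs
    rw [Measure.map_apply measurable_fst hs, withDensity_apply _ (measurable_fst hs),
      ← lintegral_indicator (measurable_fst hs),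
      lintegral_prod _ (hD.indicator (measurable_fst hs)).aemeasurable]
    have : ∀ x, ∫⁻ y, (Prod.fst ⁻¹' s).indicator D (x, y) ∂μ = s.indicator 1 x := by
      intro x
      by_cases hx : x ∈ s
      · simpa [Set.indicator, hx] using h1 x
      · simp [Set.indicator, hx]
    simp_rw [this]
    exact lintegral_indicator_one hs
  have hsnd : ((ρ.prod μ).withDensity D).map Prod.snd = μ := by
    ext s hs
    rw [Measure.map_apply measurable_snd hs, withDensity_apply _ (measurable_snd hs),
      ← lintegral_indicator (measurable_snd hs),
      lintegral_prod_symm _ (hD.indicator (measurable_snd hs)).aemeasurable]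
    have : ∀ y, ∫⁻ x, (Prod.snd ⁻¹' s).indicator D (x, y) ∂ρ = s.indicator 1 y := by
      intro y
      by_cases hy : y ∈ s
      · simpa [Set.indicator, hy] using h2 y
      · simp [Set.indicator, hy]
    simp_rw [this]
    exact lintegral_indicator_one hs
  refine ⟨⟨?_⟩, hfst, hsnd⟩
  have := congrArg (fun m => m univ) hfst
  simpa [Measure.map_apply measurable_fst MeasurableSet.univ] using this

lemma integrable_inner_prod {n : ℕ} {ρ μ : Measure (En n)} [SFinite μ] {f g : En n → En n}
    (hf : Integrable f ρ) (hg : Integrable g μ) :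
    Integrable (fun p : En n × En n => (⟪f p.1, g p.2⟫ : ℝ)) (ρ.prod μ) :=
  hf.op_fst_snd (op := fun x y => (⟪x, y⟫ : ℝ)) (by unfold Function.uncurry; fun_prop)
    ⟨1, fun x y => by simpa using norm_inner_le_norm (𝕜 := ℝ) x y⟩ hg

lemma integral_inner_prod {n : ℕ} {ρ μ : Measure (En n)} [SFinite ρ] [SFinite μ]
    {f g : En n → En n} (hf : Integrable f ρ) (hg : Integrable g μ) :
    ∫ p : En n × En n, (⟪f p.1, g p.2⟫ : ℝ) ∂(ρ.prod μ) = ⟪∫ x, f x ∂ρ, ∫ y, g y ∂μ⟫ :=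
  integral_prod_bilin (innerSL ℝ (E := En n)) hf hg

/-- A nonnegative finite sum of tensors with the right marginals gives a lower bound for `T`. -/
lemma sum_inner_le_Tcorr {n : ℕ} {ρ μ : Measure (En n)} [IsProbabilityMeasure ρ]
    [IsProbabilityMeasure μ] {ι : Type*} [Fintype ι] (a b : ι → En n → ℝ)
    (ha : ∀ i x, 0 ≤ a i x) (hb : ∀ i y, 0 ≤ b i y)
    (ham : ∀ i, Measurable (a i)) (hbm : ∀ i, Measurable (b i))
    (hai : ∀ i, Integrable (a i) ρ) (hbi : ∀ i, Integrable (b i) μ)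
    (hax : ∀ i, Integrable (fun x => a i x • x) ρ) (hby : ∀ i, Integrable (fun y => b i y • y) μ)
    (h1 : ∀ x, ∑ i, a i x * ∫ y, b i y ∂μ = 1) (h2 : ∀ y, ∑ i, (∫ x, a i x ∂ρ) * b i y = 1) :
    ((∑ i, ⟪∫ x, a i x • x ∂ρ, ∫ y, b i y • y ∂μ⟫ : ℝ) : EReal) ≤ Tcorr ρ μ := by
  set D : En n × En n → ℝ := fun p => ∑ i, a i p.1 * b i p.2 with hDdef
  have hD0 : ∀ p, 0 ≤ D p := fun p => Finset.sum_nonneg fun i _ => mul_nonneg (ha _ _) (hb _ _)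
  have hDm : Measurable D := by fun_prop
  have hterm := fun i => integrable_inner_prod (hax i) (hby i)
  have hplan : (ρ.prod μ).withDensity (fun p => ENNReal.ofReal (D p)) ∈ Plans ρ μ := by
    refine withDensity_mem_Plans hDm.ennreal_ofReal (fun x => ?_) (fun y => ?_)
    · have hint : ∀ i ∈ Finset.univ, Integrable (fun y => a i x * b i y) μ :=
        fun i _ => (hbi i).const_mul _
      rw [← ofReal_integral_eq_lintegral_ofReal (integrable_finsetSum _ hint)
        (ae_of_all _ fun y => hD0 (x, y)), integral_finsetSum _ hint]
      simp_rw [integral_const_mul, h1, ENNReal.ofReal_one]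
    · have hint : ∀ i ∈ Finset.univ, Integrable (fun x => a i x * b i y) ρ :=
        fun i _ => (hai i).mul_const _
      rw [← ofReal_integral_eq_lintegral_ofReal (integrable_finsetSum _ hint)
        (ae_of_all _ fun x => hD0 (x, y)), integral_finsetSum _ hint]
      simp_rw [integral_mul_const, h2, ENNReal.ofReal_one]
  have heq : ∀ p : En n × En n, (ENNReal.ofReal (D p)).toReal • (⟪p.1, p.2⟫ : ℝ)
      = ∑ i, (⟪a i p.1 • p.1, b i p.2 • p.2⟫ : ℝ) := by
    intro p
    rw [ENNReal.toReal_ofReal (hD0 p), smul_eq_mul, hDdef, Finset.sum_mul]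
    refine Finset.sum_congr rfl fun i _ => ?_
    rw [real_inner_smul_left, real_inner_smul_right, mul_assoc]
  have hint : Integrable (fun p : En n × En n => (⟪p.1, p.2⟫ : ℝ))
      ((ρ.prod μ).withDensity (fun p => ENNReal.ofReal (D p))) := by
    rw [integrable_withDensity_iff_integrable_smul' hDm.ennreal_ofReal (by simp)]
    simp_rw [heq]
    exact integrable_finsetSum _ fun i _ => hterm i
  refine le_trans (le_of_eq ?_) (le_iSup₂_of_le _ hplan le_rfl)
  rw [eInt_coe_of_integrable hint,
    integral_withDensity_eq_integral_toReal_smul hDm.ennreal_ofReal (by simp)]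
  simp_rw [heq]
  rw [integral_finsetSum _ fun i _ => hterm i]
  congr 1
  refine Finset.sum_congr rfl fun i _ => ?_
  exact (integral_inner_prod (hax i) (hby i)).symm

/-- Lower bound for `T(ρ, μ)` by completing the partial plan `∑ i, s i • (φ i ρ) ⊗ (g i μ)` with the
product of the remaining masses. -/
lemma sum_inner_add_remainder_le_Tcorr {n : ℕ} {ρ μ : Measure (En n)} [IsProbabilityMeasure ρ]
    [IsProbabilityMeasure μ] (hρ : P1 ρ) (hμ : P1 μ) (hρ0 : ∫ x, x ∂ρ = 0) (hμ0 : ∫ y, y ∂μ = 0)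
    {ι : Type*} [Fintype ι] (φ g : ι → En n → ℝ) (s : ι → ℝ)
    (hφm : ∀ i, Measurable (φ i)) (hgm : ∀ i, Measurable (g i))
    (hφ0 : ∀ i x, 0 ≤ φ i x) (hg0 : ∀ i y, 0 ≤ g i y) (hs : ∀ i, 0 ≤ s i)
    (hφ1 : ∀ x, ∑ i, φ i x ≤ 1) (hg1 : ∀ y, ∑ i, g i y ≤ 1)
    (hsp : ∀ i, s i * ∫ y, g i y ∂μ ≤ 1)
    (hw : ∀ y, ∑ i, s i * (∫ x, φ i x ∂ρ) * g i y ≤ 1)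
    (hm : ∑ i, s i * (∫ x, φ i x ∂ρ) * ∫ y, g i y ∂μ < 1) :
    ((∑ i, s i * ⟪∫ x, φ i x • x ∂ρ, ∫ y, g i y • y ∂μ⟫
      + (1 - ∑ i, s i * (∫ x, φ i x ∂ρ) * ∫ y, g i y ∂μ)⁻¹ *
        ⟪∑ i, (s i * ∫ y, g i y ∂μ) • ∫ x, φ i x • x ∂ρ,
          ∑ i, (s i * ∫ x, φ i x ∂ρ) • ∫ y, g i y • y ∂μ⟫ : ℝ) : EReal) ≤ Tcorr ρ μ := by
  have hφle : ∀ i x, ‖φ i x‖ ≤ 1 := fun i x => by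
    rw [Real.norm_of_nonneg (hφ0 i x)]
    exact (Finset.single_le_sum (fun j _ => hφ0 j x) (Finset.mem_univ i)).trans (hφ1 x)
  have hgle : ∀ i y, ‖g i y‖ ≤ 1 := fun i y => by
    rw [Real.norm_of_nonneg (hg0 i y)]
    exact (Finset.single_le_sum (fun j _ => hg0 j y) (Finset.mem_univ i)).trans (hg1 y)
  have hφi : ∀ i, Integrable (φ i) ρ := fun i =>
    Integrable.of_bound (hφm i).aestronglyMeasurable 1 (ae_of_all _ (hφle i))
  have hgi : ∀ i, Integrable (g i) μ := fun i =>
    Integrable.of_bound (hgm i).aestronglyMeasurable 1 (ae_of_all _ (hgle i))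
  have hφx : ∀ i, Integrable (fun x => φ i x • x) ρ := fun i =>
    hρ.integrable_id.bdd_smul 1 (hφm i).aestronglyMeasurable (ae_of_all _ (hφle i))
  have hgy : ∀ i, Integrable (fun y => g i y • y) μ := fun i =>
    hμ.integrable_id.bdd_smul 1 (hgm i).aestronglyMeasurable (ae_of_all _ (hgle i))
  set p : ι → ℝ := fun i => ∫ y, g i y ∂μ with hp
  set q : ι → ℝ := fun i => ∫ x, φ i x ∂ρ with hq
  set m : ℝ := 1 - ∑ i, s i * q i * p i with hmdef
  have hmpos : 0 < m := sub_pos.2 hm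
  set u : En n → ℝ := fun x => 1 - ∑ i, s i * p i * φ i x with hu
  set w : En n → ℝ := fun y => 1 - ∑ i, s i * q i * g i y with hwdef
  have hsumφ : Integrable (fun x => ∑ i, s i * p i * φ i x) ρ :=
    integrable_finsetSum _ fun i _ => (hφi i).const_mul _
  have hsumg : Integrable (fun y => ∑ i, s i * q i * g i y) μ :=
    integrable_finsetSum _ fun i _ => (hgi i).const_mul _
  have hui : Integrable u ρ := (integrable_const 1).sub hsumφ
  have hwi : Integrable w μ := (integrable_const 1).sub hsumg
  have huint : ∫ x, u x ∂ρ = m := by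
    rw [integral_sub (integrable_const 1) hsumφ,
      integral_finsetSum _ fun i _ => (hφi i).const_mul _]
    simp only [integral_const_mul, integral_const, probReal_univ, smul_eq_mul, mul_one, hmdef]
    congr 1
    exact Finset.sum_congr rfl fun i _ => by ring
  have hwint : ∫ y, w y ∂μ = m := by
    rw [integral_sub (integrable_const 1) hsumg,
      integral_finsetSum _ fun i _ => (hgi i).const_mul _]
    simp only [integral_const_mul, integral_const, probReal_univ, smul_eq_mul, mul_one, hmdef, hp]
  have hux : ∀ x, u x • x = x - ∑ i, (s i * p i) • (φ i x • x) := fun x => by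
    simp only [hu, sub_smul, one_smul, Finset.sum_smul, mul_smul]
  have hwy : ∀ y, w y • y = y - ∑ i, (s i * q i) • (g i y • y) := fun y => by
    simp only [hwdef, sub_smul, one_smul, Finset.sum_smul, mul_smul]
  have hsumφx : Integrable (fun x => ∑ i, (s i * p i) • (φ i x • x)) ρ :=
    integrable_finsetSum _ fun i _ => (hφx i).fun_smul (s i * p i)
  have hsumgy : Integrable (fun y => ∑ i, (s i * q i) • (g i y • y)) μ :=
    integrable_finsetSum _ fun i _ => (hgy i).fun_smul (s i * q i)
  have huxi : Integrable (fun x => u x • x) ρ := by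
    simp_rw [hux]; exact hρ.integrable_id.sub hsumφx
  have hwyi : Integrable (fun y => w y • y) μ := by
    simp_rw [hwy]; exact hμ.integrable_id.sub hsumgy
  have huxint : ∫ x, u x • x ∂ρ = -∑ i, (s i * p i) • ∫ x, φ i x • x ∂ρ := by
    simp_rw [hux]
    rw [integral_sub hρ.integrable_id hsumφx, hρ0, zero_sub,
      integral_finsetSum _ fun i _ => (hφx i).fun_smul _]
    simp_rw [integral_smul]
  have hwyint : ∫ y, w y • y ∂μ = -∑ i, (s i * q i) • ∫ y, g i y • y ∂μ := by
    simp_rw [hwy]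
    rw [integral_sub hμ.integrable_id hsumgy, hμ0, zero_sub,
      integral_finsetSum _ fun i _ => (hgy i).fun_smul _]
    simp_rw [integral_smul]
  have hu0 : ∀ x, 0 ≤ u x := fun x => by
    have : ∑ i, s i * p i * φ i x ≤ ∑ i, φ i x := Finset.sum_le_sum fun i _ => by
      simpa using mul_le_mul_of_nonneg_right (hsp i) (hφ0 i x)
    have := hφ1 x
    simp only [hu]; linarith
  have key := sum_inner_le_Tcorr (ρ := ρ) (μ := μ) (ι := Option ι)
    (fun o => o.elim u φ) (fun o => o.elim (fun y => m⁻¹ * w y) (fun i y => s i * g i y))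
    (by rintro (_ | i) x; exacts [hu0 x, hφ0 i x])
    (by
      rintro (_ | i) y
      · exact mul_nonneg (inv_nonneg.2 hmpos.le) (sub_nonneg.2 (hw y))
      · exact mul_nonneg (hs i) (hg0 i y))
    (by rintro (_ | i); exacts [by simp only [Option.elim, hu]; fun_prop, hφm i])
    (by rintro (_ | i) <;> simp only [Option.elim, hwdef] <;> fun_prop)
    (by rintro (_ | i); exacts [hui, hφi i])
    (by rintro (_ | i); exacts [hwi.const_mul _, (hgi i).const_mul _])
    (by rintro (_ | i); exacts [huxi, hφx i])
    (by
      rintro (_ | i)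
      · simpa only [Option.elim, mul_smul] using hwyi.fun_smul m⁻¹
      · simpa only [Option.elim, mul_smul] using (hgy i).fun_smul (s i))
    (by
      intro x
      simp only [Fintype.sum_option, Option.elim, integral_const_mul, hwint,
        inv_mul_cancel₀ hmpos.ne', hu]
      rw [mul_one, sub_add_eq_add_sub, add_sub_assoc, ← Finset.sum_sub_distrib,
        Finset.sum_eq_zero, add_zero]
      intro i _
      simp only [hp]; ring)
    (by
      intro y
      simp only [Fintype.sum_option, Option.elim, huint, mul_inv_cancel_left₀ hmpos.ne', hwdef]
      rw [sub_add_eq_add_sub, add_sub_assoc, ← Finset.sum_sub_distrib,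
        Finset.sum_eq_zero, add_zero]
      intro i _
      simp only [hq]; ring)
  refine le_trans (le_of_eq ?_) key
  congr 1
  simp only [Fintype.sum_option, Option.elim, mul_smul, integral_smul, huxint, hwyint,
    real_inner_smul_right, inner_neg_left, inner_neg_right, mul_neg, neg_neg, hp, hq]
  rw [add_comm]

/-- Weak convergence passes to integrals of bounded continuous vector-valued functions. -/
lemma tendsto_integral_of_bounded_continuous {n : ℕ} {ρseq : ℕ → Measure (En n)}
    [∀ k, IsFiniteMeasure (ρseq k)] {ρ : Measure (En n)} [IsFiniteMeasure ρ]
    (hweak : ∀ g : BoundedContinuousFunction (En n) ℝ,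
      Tendsto (fun k => ∫ x, g x ∂(ρseq k)) atTop (𝓝 (∫ x, g x ∂ρ)))
    {f : En n → En n} (hf : Continuous f) {C : ℝ} (hC : ∀ x, ‖f x‖ ≤ C) :
    Tendsto (fun k => ∫ x, f x ∂(ρseq k)) atTop (𝓝 (∫ x, f x ∂ρ)) := by
  set b := EuclideanSpace.basisFun (Fin n) ℝ
  have hint : ∀ ν : Measure (En n), IsFiniteMeasure ν → Integrable f ν := fun ν _ =>
    Integrable.of_bound hf.aestronglyMeasurable C (ae_of_all _ hC)
  have hrep : ∀ ν : Measure (En n), IsFiniteMeasure ν →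
      ∫ x, f x ∂ν = ∑ i, (∫ x, ⟪b i, f x⟫ ∂ν) • b i := fun ν hν => by
    simp_rw [integral_inner (hint ν hν)]
    exact (b.sum_repr' _).symm
  rw [hrep ρ inferInstance]
  simp_rw [fun k => hrep (ρseq k) inferInstance]
  refine tendsto_finsetSum _ fun i _ => Tendsto.smul_const ?_ _
  exact hweak (BoundedContinuousFunction.ofNormedAddCommGroup (fun x => (⟪b i, f x⟫ : ℝ))
    (by fun_prop) C fun x => (norm_inner_le_norm _ _).trans (by simpa using hC x))

lemma eventually_le_Tcorr_of_tensor {n : ℕ} {μ : Measure (En n)} [IsProbabilityMeasure μ]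
    (hμ1 : P1 μ) (hbar : ∫ y, y ∂μ = (0 : En n))
    {ρseq : ℕ → Measure (En n)} (hprob : ∀ k, IsProbabilityMeasure (ρseq k))
    (hP1 : ∀ k, P1 (ρseq k)) (hcent : ∀ k, ∫ x, x ∂(ρseq k) = (0 : En n))
    {ρ : Measure (En n)} [IsProbabilityMeasure ρ]
    (hweak : ∀ g : BoundedContinuousFunction (En n) ℝ,
      Tendsto (fun k => ∫ x, g x ∂(ρseq k)) atTop (𝓝 (∫ x, g x ∂ρ)))
    {ι : Type*} [Fintype ι] (φ g : ι → En n → ℝ)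
    (hφc : ∀ i, Continuous (φ i)) (hgm : ∀ i, Measurable (g i))
    (hφ0 : ∀ i x, 0 ≤ φ i x) (hg0 : ∀ i y, 0 ≤ g i y)
    (hφ1 : ∀ x, ∑ i, φ i x ≤ 1) {R : ℝ} (hφR : ∀ i x, φ i x ≠ 0 → ‖x‖ ≤ R)
    {δ : ℝ} (hδ : 0 < δ) (hg1 : ∀ y, ∑ i, g i y ≤ 1 - δ)
    (hle : ∀ i, ∫ y, g i y ∂μ ≤ ∫ x, φ i x ∂ρ)
    (hzero : ∑ i, ∫ y, g i y • y ∂μ = 0) {c : ℝ}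
    (hc : c < ∑ i, (∫ x, φ i x ∂ρ)⁻¹ * ⟪∫ x, φ i x • x ∂ρ, ∫ y, g i y • y ∂μ⟫) :
    ∀ᶠ k in atTop, (c : EReal) ≤ Tcorr (ρseq k) μ := by
  have hφle : ∀ i x, ‖φ i x‖ ≤ 1 := fun i x => by
    rw [Real.norm_of_nonneg (hφ0 i x)]
    exact (Finset.single_le_sum (fun j _ => hφ0 j x) (Finset.mem_univ i)).trans (hφ1 x)
  have hgle : ∀ i y, ‖g i y‖ ≤ 1 := fun i y => by
    rw [Real.norm_of_nonneg (hg0 i y)]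
    exact ((Finset.single_le_sum (fun j _ => hg0 j y) (Finset.mem_univ i)).trans (hg1 y)).trans
      (by linarith)
  have hgi : ∀ i, Integrable (g i) μ := fun i =>
    Integrable.of_bound (hgm i).aestronglyMeasurable 1 (ae_of_all _ (hgle i))
  have hφxle : ∀ i x, ‖φ i x • x‖ ≤ max R 0 := fun i x => by
    by_cases h : φ i x = 0
    · simp [h]
    · rw [norm_smul]
      calc ‖φ i x‖ * ‖x‖ ≤ 1 * R := mul_le_mul (hφle i x) (hφR i x h) (norm_nonneg _) zero_le_one
        _ ≤ max R 0 := by simp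
  set p : ι → ℝ := fun i => ∫ y, g i y ∂μ
  set B : ι → En n := fun i => ∫ y, g i y • y ∂μ
  set a : ι → ℝ := fun i => ∫ x, φ i x ∂ρ
  set q : ℕ → ι → ℝ := fun k i => ∫ x, φ i x ∂(ρseq k)
  set X : ι → En n := fun i => ∫ x, φ i x • x ∂ρ
  set Y : ℕ → ι → En n := fun k i => ∫ x, φ i x • x ∂(ρseq k)
  have hp0 : ∀ i, 0 ≤ p i := fun i => integral_nonneg (hg0 i)
  have ha0 : ∀ i, 0 ≤ a i := fun i => integral_nonneg (hφ0 i)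
  have hqlim : ∀ i, Tendsto (fun k => q k i) atTop (𝓝 (a i)) := fun i =>
    hweak (BoundedContinuousFunction.ofNormedAddCommGroup (φ i) (hφc i) 1 (hφle i))
  have hYlim : ∀ i, Tendsto (fun k => Y k i) atTop (𝓝 (X i)) := fun i =>
    tendsto_integral_of_bounded_continuous hweak ((hφc i).smul continuous_id) (hφxle i)
  have hinv : ∀ i, (a i)⁻¹ * a i ≤ 1 := fun i => by
    rcases eq_or_ne (a i) 0 with h | h
    · simp [h]
    · rw [inv_mul_cancel₀ h]
  have hgzero : ∀ i, a i = 0 → B i = 0 := fun i h => by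
    have : g i =ᵐ[μ] 0 := (integral_eq_zero_iff_of_nonneg (hg0 i) (hgi i)).1
      (le_antisymm ((hle i).trans h.le) (hp0 i))
    refine integral_eq_zero_of_ae ?_
    filter_upwards [this] with y hy
    simp [hy]
  have hBinv : ∀ i, ((a i)⁻¹ * a i) • B i = B i := fun i => by
    rcases eq_or_ne (a i) 0 with h | h
    · simp [hgzero i h]
    · rw [inv_mul_cancel₀ h, one_smul]
  have hsump : ∑ i, p i ≤ 1 - δ := by
    rw [← integral_finsetSum _ fun i _ => hgi i]
    calc ∫ y, ∑ i, g i y ∂μ ≤ ∫ _, (1 - δ) ∂μ :=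
          integral_mono (integrable_finsetSum _ fun i _ => hgi i) (integrable_const _) hg1
      _ = 1 - δ := by simp
  have hratio : ∀ᶠ k in atTop, ∀ i, (a i)⁻¹ * q k i ≤ 1 + δ :=
    eventually_all.2 fun i => by
      have : Tendsto (fun k => (a i)⁻¹ * q k i) atTop (𝓝 ((a i)⁻¹ * a i)) :=
        (hqlim i).const_mul _
      filter_upwards [this.eventually_lt_const ((hinv i).trans_lt (by linarith : 1 < 1 + δ))]
        with k hk using hk.le
  have hmlim : Tendsto (fun k => 1 - ∑ i, (a i)⁻¹ * q k i * p i) atTop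
      (𝓝 (1 - ∑ i, (a i)⁻¹ * a i * p i)) :=
    tendsto_const_nhds.sub (tendsto_finsetSum _ fun i _ => ((hqlim i).const_mul _).mul_const _)
  have hmpos : 0 < 1 - ∑ i, (a i)⁻¹ * a i * p i := by
    have : ∑ i, (a i)⁻¹ * a i * p i ≤ ∑ i, p i := Finset.sum_le_sum fun i _ => by
      simpa using mul_le_mul_of_nonneg_right (hinv i) (hp0 i)
    linarith
  have hlim := (tendsto_finsetSum Finset.univ fun i _ =>
      (((hYlim i).inner (tendsto_const_nhds (x := B i))).const_mul (a i)⁻¹)).add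
    ((hmlim.inv₀ hmpos.ne').mul
      ((tendsto_finsetSum Finset.univ fun i _ => (hYlim i).const_smul ((a i)⁻¹ * p i)).inner
      (tendsto_finsetSum Finset.univ fun i _ =>
        ((hqlim i).const_mul (a i)⁻¹).smul_const (B i))))
  simp_rw [hBinv] at hlim
  rw [hzero, inner_zero_right, mul_zero, add_zero] at hlim
  filter_upwards [hlim.eventually_const_lt hc, hratio, hmlim.eventually_const_lt hmpos]
    with k hk hr hm
  have := hprob k
  refine le_trans (EReal.coe_le_coe_iff.2 hk.le) ?_
  refine sum_inner_add_remainder_le_Tcorr (hP1 k) hμ1 (hcent k) hbar φ g (fun i => (a i)⁻¹)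
    (fun i => (hφc i).measurable) hgm hφ0 hg0 (fun i => inv_nonneg.2 (ha0 i)) hφ1
    (fun y => (hg1 y).trans (by linarith)) (fun i => ?_) (fun y => ?_) (by linarith)
  · exact (mul_le_mul_of_nonneg_left (hle i) (inv_nonneg.2 (ha0 i))).trans (hinv i)
  · calc ∑ i, (a i)⁻¹ * q k i * g i y ≤ ∑ i, (1 + δ) * g i y :=
          Finset.sum_le_sum fun i _ => mul_le_mul_of_nonneg_right (hr i) (hg0 i y)
      _ = (1 + δ) * ∑ i, g i y := (Finset.mul_sum _ _ _).symm
      _ ≤ (1 + δ) * (1 - δ) := mul_le_mul_of_nonneg_left (hg1 y) (by linarith)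
      _ ≤ 1 := by nlinarith [sq_nonneg δ]

/-- A finite continuous partition of unity on the ball of radius `R`, with small supports. -/
lemma exists_partition_of_unity_ball (n : ℕ) (R : ℝ) {ε : ℝ} (hε : 0 < ε) :
    ∃ (t : Finset (En n)) (φ : t → En n → ℝ), (∀ i, Continuous (φ i)) ∧ (∀ i x, 0 ≤ φ i x) ∧
      (∀ x, ∑ i, φ i x ≤ 1) ∧ (∀ x, ‖x‖ ≤ R → ∑ i, φ i x = 1) ∧
      (∀ i x, φ i x ≠ 0 → ‖x - i‖ ≤ ε) ∧ (∀ i x, φ i x ≠ 0 → ‖x‖ ≤ R + ε) := by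
  obtain ⟨s, hsub, hfin, hcov⟩ :=
    (isCompact_closedBall (0 : En n) R).finite_cover_balls (half_pos hε)
  obtain ⟨t, rfl⟩ := hfin.exists_finset_coe
  set ψ : t → En n → ℝ := fun i x => max 0 (ε - ‖x - i‖) with hψ
  set S : En n → ℝ := fun x => ∑ i, ψ i x
  have hψ0 : ∀ i x, 0 ≤ ψ i x := fun i x => le_max_left _ _
  have hψc : ∀ i, Continuous (ψ i) := fun i => by fun_prop
  have hM : ∀ x, 0 < max (S x) (ε / 2) := fun x => lt_max_of_lt_right (half_pos hε)
  have hsum : ∀ x, ∑ i, ψ i x / max (S x) (ε / 2) = S x / max (S x) (ε / 2) := fun x =>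
    (Finset.sum_div _ _ _).symm
  have hnear : ∀ i x, ψ i x / max (S x) (ε / 2) ≠ 0 → ‖x - i‖ ≤ ε := fun i x h => by
    by_contra! hlt
    exact h (by rw [hψ]; simp [max_eq_left (by linarith : ε - ‖x - i‖ ≤ 0)])
  refine ⟨t, fun i x => ψ i x / max (S x) (ε / 2), fun i => ?_, fun i x => ?_, fun x => ?_,
    fun x hx => ?_, hnear, fun i x h => ?_⟩
  · exact (hψc i).div (by fun_prop) fun x => (hM x).ne'
  · exact div_nonneg (hψ0 i x) (hM x).le
  · rw [hsum, div_le_one (hM x)]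
    exact le_max_left _ _
  · rw [hsum]
    obtain ⟨c, hc, hxc⟩ := mem_iUnion₂.1 (hcov (mem_closedBall_zero_iff.2 hx))
    have h1 : ε / 2 ≤ ψ ⟨c, hc⟩ x := by
      rw [Metric.mem_ball, dist_eq_norm] at hxc
      exact le_max_of_le_right (by simp only; linarith)
    have h2 : ε / 2 ≤ S x :=
      h1.trans (Finset.single_le_sum (fun j _ => hψ0 j x) (Finset.mem_univ _))
    rw [max_eq_left h2, div_self (by linarith)]
  · have h1 := hnear i x h
    have h2 : ‖(i : En n)‖ ≤ R := mem_closedBall_zero_iff.1 (hsub i.2)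
    calc ‖x‖ = ‖(i : En n) + (x - i)‖ := by rw [add_sub_cancel]
      _ ≤ ‖(i : En n)‖ + ‖x - i‖ := norm_add_le _ _
      _ ≤ R + ε := add_le_add h2 h1

lemma exists_kernel_of_mem_Plans {n : ℕ} {ρ μ : Measure (En n)} {γ : Measure (En n × En n)}
    (hγ : γ ∈ Plans ρ μ) :
    ∃ κ : ProbabilityTheory.Kernel (En n) (En n), ProbabilityTheory.IsMarkovKernel κ ∧
      (μ.compProd κ).map MeasurableEquiv.prodComm = γ := by
  obtain ⟨hprob, -, hsnd⟩ := hγ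
  have : IsProbabilityMeasure (γ.map Prod.swap) :=
    Measure.isProbabilityMeasure_map measurable_swap.aemeasurable
  refine ⟨(γ.map Prod.swap).condKernel, inferInstance, ?_⟩
  have hfst : (γ.map Prod.swap).fst = μ := by
    rw [Measure.fst_map_swap, Measure.snd, hsnd]
  have := (γ.map Prod.swap).disintegrate (γ.map Prod.swap).condKernel
  rw [hfst] at this
  rw [this]
  change (γ.map Prod.swap).map Prod.swap = γ
  rw [Measure.map_map measurable_swap measurable_swap, Prod.swap_swap_eq, Measure.map_id]

lemma integral_integral_kernel {n : ℕ} {μ : Measure (En n)} [IsProbabilityMeasure μ]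
    {γ : Measure (En n × En n)} {κ : ProbabilityTheory.Kernel (En n) (En n)}
    [ProbabilityTheory.IsMarkovKernel κ]
    (hκ : (μ.compProd κ).map MeasurableEquiv.prodComm = γ)
    {F : Type*} [NormedAddCommGroup F] [NormedSpace ℝ F] {f : En n × En n → F}
    (hf : Integrable f γ) : ∫ y, ∫ x, f (x, y) ∂(κ y) ∂μ = ∫ p, f p ∂γ := by
  subst hκ
  rw [integrable_map_equiv] at hf
  rw [integral_map_equiv]
  exact (Measure.integral_compProd hf).symm

lemma eventually_le_Tcorr_of_cutoff {n : ℕ} {μ : Measure (En n)} [IsProbabilityMeasure μ]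
    (hμ1 : P1 μ) (hbar : ∫ y, y ∂μ = (0 : En n))
    {ρseq : ℕ → Measure (En n)} (hprob : ∀ k, IsProbabilityMeasure (ρseq k))
    (hP1 : ∀ k, P1 (ρseq k)) (hcent : ∀ k, ∫ x, x ∂(ρseq k) = (0 : En n))
    {ρ : Measure (En n)} [IsProbabilityMeasure ρ]
    (hweak : ∀ g : BoundedContinuousFunction (En n) ℝ,
      Tendsto (fun k => ∫ x, g x ∂(ρseq k)) atTop (𝓝 (∫ x, g x ∂ρ)))
    {γ : Measure (En n × En n)} (hγ : γ ∈ Plans ρ μ) {h : En n × En n → ℝ} (hm : Measurable h)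
    {δ : ℝ} (hδ : 0 < δ) (h0 : ∀ p, 0 ≤ h p) (h1 : ∀ p, h p ≤ 1 - δ)
    {R : ℝ} (hR : ∀ p, h p ≠ 0 → ‖p.1‖ ≤ R) (hzero : ∫ p, h p • p.2 ∂γ = 0)
    {c : ℝ} (hc : c < ∫ p, h p * ⟪p.1, p.2⟫ ∂γ) :
    ∀ᶠ k in atTop, (c : EReal) ≤ Tcorr (ρseq k) μ := by
  obtain ⟨κ, hκM, hκ⟩ := exists_kernel_of_mem_Plans hγ
  obtain ⟨hγp, hfst, hsnd⟩ := hγ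
  have hy : Integrable (fun p : En n × En n => p.2) γ := by
    have := hμ1.integrable_id
    rw [← hsnd] at this
    exact this.comp_measurable measurable_snd
  set M : ℝ := ∫ p, ‖p.2‖ ∂γ
  have hM0 : 0 ≤ M := integral_nonneg fun _ => norm_nonneg _
  set I : ℝ := ∫ p, h p * ⟪p.1, p.2⟫ ∂γ
  set ε : ℝ := (I - c) / (2 * (M + 1)) with hεdef
  have hε : 0 < ε := div_pos (sub_pos.2 hc) (by linarith)
  have hεM : 2 * ε * M < I - c := by
    have : I - c = 2 * ε * (M + 1) := by rw [hεdef]; field_simp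
    rw [this]; nlinarith
  obtain ⟨t, φ, hφc, hφ0, hφ1, hφ1', hφε, hφR⟩ := exists_partition_of_unity_ball n R hε
  have hφle : ∀ i x, φ i x ≤ 1 := fun i x =>
    (Finset.single_le_sum (fun j _ => hφ0 j x) (Finset.mem_univ i)).trans (hφ1 x)
  have hsum : ∀ p, ∑ i, φ i p.1 * h p = h p := fun p => by
    rw [← Finset.sum_mul]
    by_cases hp : h p = 0
    · simp [hp]
    · rw [hφ1' _ (hR p hp), one_mul]
  have hk0 : ∀ i p, 0 ≤ φ i p.1 * h p := fun i p => mul_nonneg (hφ0 _ _) (h0 _)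
  have hkle : ∀ i p, φ i p.1 * h p ≤ 1 := fun i p =>
    mul_le_one₀ (hφle _ _) (h0 _) ((h1 p).trans (by linarith))
  have hkn : ∀ i p, ‖φ i p.1 * h p‖ ≤ 1 := fun i p => by
    rw [Real.norm_of_nonneg (hk0 i p)]; exact hkle i p
  have hφm : ∀ i, Measurable (φ i) := fun i => (hφc i).measurable
  have hkm : ∀ i, Measurable (fun p : En n × En n => φ i p.1 * h p) := fun i => by fun_prop
  have hki : ∀ i (ν : Measure (En n × En n)), IsFiniteMeasure ν →
      Integrable (fun p : En n × En n => φ i p.1 * h p) ν := fun i ν _ =>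
    Integrable.of_bound (hkm i).aestronglyMeasurable 1 (ae_of_all _ (hkn i))
  have hky : ∀ i, Integrable (fun p : En n × En n => (φ i p.1 * h p) • p.2) γ := fun i =>
    hy.bdd_smul 1 (hkm i).aestronglyMeasurable (ae_of_all _ (hkn i))
  have hkyn : ∀ i, Integrable (fun p : En n × En n => (φ i p.1 * h p) * ‖p.2‖) γ := fun i =>
    hy.norm.bdd_smul 1 (hkm i).aestronglyMeasurable (ae_of_all _ (hkn i))
  have hkxy : ∀ i, Integrable (fun p : En n × En n => (φ i p.1 * h p) * ⟪p.1, p.2⟫) γ := by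
    intro i
    refine (hy.norm.const_mul |R + ε|).mono' (by fun_prop) (ae_of_all _ fun p => ?_)
    rw [norm_mul]
    by_cases hz : φ i p.1 = 0
    · simpa [hz] using mul_nonneg (abs_nonneg (R + ε)) (norm_nonneg p.2)
    · calc ‖φ i p.1 * h p‖ * ‖(⟪p.1, p.2⟫ : ℝ)‖ ≤ 1 * (‖p.1‖ * ‖p.2‖) :=
            mul_le_mul (hkn i p) (norm_inner_le_norm _ _) (norm_nonneg _) zero_le_one
        _ ≤ |R + ε| * ‖p.2‖ := by
            rw [one_mul]
            exact mul_le_mul_of_nonneg_right ((hφR i _ hz).trans (le_abs_self _)) (norm_nonneg _)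
  set g : t → En n → ℝ := fun i y => ∫ x, φ i x * h (x, y) ∂(κ y) with hg
  have hgint : ∀ i, ∫ y, g i y ∂μ = ∫ p, φ i p.1 * h p ∂γ := fun i =>
    integral_integral_kernel hκ (hki i γ inferInstance)
  have hgyint : ∀ i, ∫ y, g i y • y ∂μ = ∫ p, (φ i p.1 * h p) • p.2 ∂γ := fun i => by
    rw [← integral_integral_kernel hκ (hky i)]
    simp_rw [integral_smul_const, hg]
  have hφint : ∀ i, ∫ x, φ i x ∂ρ = ∫ p, φ i p.1 ∂γ := fun i => by
    rw [← hfst, integral_map measurable_fst.aemeasurable (hφm i).aestronglyMeasurable]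
  have hφi : ∀ i, Integrable (fun p : En n × En n => φ i p.1) γ := fun i =>
    Integrable.of_bound (by fun_prop) 1 (ae_of_all _ fun p => by
      rw [Real.norm_of_nonneg (hφ0 i _)]; exact hφle i _)
  have hslice : ∀ i y, Integrable (fun x => φ i x * h (x, y)) (κ y) := fun i y =>
    Integrable.of_bound (by fun_prop) 1 (ae_of_all _ fun x => hkn i (x, y))
  refine eventually_le_Tcorr_of_tensor hμ1 hbar hprob hP1 hcent hweak φ g hφc (fun i => ?_) hφ0
    (fun i y => integral_nonneg fun x => hk0 i (x, y)) hφ1 hφR hδ (fun y => ?_) (fun i => ?_) ?_ ?_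
  · exact (StronglyMeasurable.integral_kernel_prod_right' (κ := κ)
      (f := fun p : En n × En n => φ i p.2 * h (p.2, p.1))
      (by fun_prop : Measurable _).stronglyMeasurable).measurable
  · rw [hg, ← integral_finsetSum _ fun i _ => hslice i y]
    simp_rw [fun x => hsum (x, y)]
    calc ∫ x, h (x, y) ∂(κ y) ≤ ∫ _, (1 - δ) ∂(κ y) :=
          integral_mono (Integrable.of_bound
            (hm.comp measurable_prodMk_right).aestronglyMeasurable 1 (ae_of_all _ fun x => by
            rw [Real.norm_of_nonneg (h0 _)]; linarith [h1 (x, y)])) (integrable_const _)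
            fun x => h1 (x, y)
      _ = 1 - δ := by simp
  · rw [hgint, hφint]
    refine integral_mono (hki i γ inferInstance) (hφi i) fun p => ?_
    exact mul_le_of_le_one_right (hφ0 _ _) ((h1 p).trans (by linarith))
  · simp_rw [hgyint]
    rw [← integral_finsetSum _ fun i _ => hky i]
    simp_rw [← Finset.sum_smul, hsum, hzero]
  · set N : t → ℝ := fun i => ∫ p, (φ i p.1 * h p) * ‖p.2‖ ∂γ with hN
    have hN0 : ∀ i, 0 ≤ N i := fun i =>
      integral_nonneg fun p => mul_nonneg (hk0 i p) (norm_nonneg _)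
    have hNM : ∑ i, N i ≤ M := by
      rw [hN, ← integral_finsetSum _ fun i _ => hkyn i]
      refine integral_mono (integrable_finsetSum _ fun i _ => hkyn i) hy.norm fun p => ?_
      simp only [← Finset.sum_mul, hsum]
      exact mul_le_of_le_one_left (norm_nonneg _) ((h1 p).trans (by linarith))
    have hIsum : I = ∑ i, ∫ p, (φ i p.1 * h p) * ⟪p.1, p.2⟫ ∂γ := by
      rw [← integral_finsetSum _ fun i _ => hkxy i]
      refine integral_congr_ae (ae_of_all _ fun p => ?_)
      simp only [← Finset.sum_mul, hsum]
    have hterm : ∀ i, ∫ p, (φ i p.1 * h p) * ⟪p.1, p.2⟫ ∂γ - 2 * ε * N i ≤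
        (∫ x, φ i x ∂ρ)⁻¹ * ⟪∫ x, φ i x • x ∂ρ, ∫ y, g i y • y ∂μ⟫ := by
      intro i
      rw [hgyint]
      set a : ℝ := ∫ x, φ i x ∂ρ with ha
      set B : En n := ∫ p, (φ i p.1 * h p) • p.2 ∂γ with hB
      have hBN : ‖B‖ ≤ N i := by
        refine (norm_integral_le_integral_norm _).trans (le_of_eq ?_)
        refine integral_congr_ae (ae_of_all _ fun p => ?_)
        simp only [norm_smul, Real.norm_of_nonneg (hk0 i p)]
      have hJ : ∫ p, (φ i p.1 * h p) * ⟪p.1, p.2⟫ ∂γ ≤ ⟪(i : En n), B⟫ + ε * N i := by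
        rw [hB, ← integral_inner (hky i), hN, ← integral_const_mul, ← integral_add
          ((hky i).const_inner _) ((hkyn i).const_mul _)]
        refine integral_mono (hkxy i) (((hky i).const_inner _).add ((hkyn i).const_mul _))
          fun p => ?_
        by_cases hz : φ i p.1 = 0
        · simp [hz]
        · have h3 : (⟪p.1, p.2⟫ : ℝ) ≤ ⟪(i : En n), p.2⟫ + ε * ‖p.2‖ := by
            have h4 : (⟪p.1 - i, p.2⟫ : ℝ) ≤ ε * ‖p.2‖ := (real_inner_le_norm _ _).trans
              (mul_le_mul_of_nonneg_right (hφε i _ hz) (norm_nonneg _))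
            rw [inner_sub_left] at h4
            linarith
          have := mul_le_mul_of_nonneg_left h3 (hk0 i p)
          simp only [real_inner_smul_right]
          linarith
      rcases eq_or_ne a 0 with hz | hz
      · have hae : (fun p : En n × En n => φ i p.1) =ᵐ[γ] 0 :=
          (integral_eq_zero_iff_of_nonneg (fun p : En n × En n => hφ0 i p.1)
            (hφi i)).1 ((hφint i).symm.trans hz)
        have hB0 : B = 0 := integral_eq_zero_of_ae (by
          filter_upwards [hae] with p hp
          simp only [Pi.zero_apply] at hp
          simp [hp])
        rw [hB0, inner_zero_right] at hJ ⊢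
        nlinarith [hN0 i]
      · have ha0 : 0 < a := lt_of_le_of_ne (integral_nonneg (hφ0 i)) hz.symm
        have hφρ : Integrable (φ i) ρ := Integrable.of_bound (by fun_prop) 1
          (ae_of_all _ fun x => by rw [Real.norm_of_nonneg (hφ0 i _)]; exact hφle i _)
        have hφxn : ∀ x, ‖φ i x • (x - i)‖ ≤ ε * φ i x := fun x => by
          rw [norm_smul, Real.norm_of_nonneg (hφ0 i x), mul_comm]
          by_cases hzx : φ i x = 0
          · simp [hzx]
          · exact mul_le_mul_of_nonneg_right (hφε i x hzx) (hφ0 i x)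
        have hφxi : Integrable (fun x => φ i x • (x - (i : En n))) ρ :=
          (hφρ.const_mul ε).mono' (by fun_prop) (ae_of_all _ hφxn)
        have hX : ∫ x, φ i x • x ∂ρ = a • (i : En n) + ∫ x, φ i x • (x - (i : En n)) ∂ρ := by
          rw [ha, ← integral_smul_const, ← integral_add (hφρ.smul_const _) hφxi]
          simp_rw [← smul_add, add_sub_cancel]
        have hE : ‖∫ x, φ i x • (x - (i : En n)) ∂ρ‖ ≤ ε * a := by
          rw [ha, ← integral_const_mul]
          exact norm_integral_le_of_norm_le (hφρ.const_mul ε) (ae_of_all _ hφxn)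
        rw [hX, inner_add_left, real_inner_smul_left, mul_add, inv_mul_cancel_left₀ hz]
        have h5 : -(ε * N i) ≤ a⁻¹ * ⟪∫ x, φ i x • (x - (i : En n)) ∂ρ, B⟫ := by
          have h6 := (abs_le.1 (abs_real_inner_le_norm (∫ x, φ i x • (x - (i : En n)) ∂ρ) B)).1
          have h7 := mul_le_mul hE hBN (norm_nonneg _) (by positivity)
          rw [inv_mul_eq_div, le_div_iff₀ ha0]
          linarith
        linarith
    calc c < I - 2 * ε * ∑ i, N i := by
          have := mul_le_mul_of_nonneg_left hNM (by positivity : 0 ≤ 2 * ε)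
          linarith
      _ = ∑ i, (∫ p, (φ i p.1 * h p) * ⟪p.1, p.2⟫ ∂γ - 2 * ε * N i) := by
          rw [hIsum, Finset.sum_sub_distrib, Finset.mul_sum]
      _ ≤ _ := Finset.sum_le_sum fun i _ => hterm i

/-- A sequence tending to `0` in a finite-dimensional space is a combination of finitely many of
its terms, with coefficients tending to `0`. -/
lemma exists_coeff_tendsto_zero {E : Type*} [NormedAddCommGroup E] [NormedSpace ℝ E]
    [FiniteDimensional ℝ E] {v : ℕ → E} (hv : Tendsto v atTop (𝓝 0)) :
    ∃ (N : ℕ) (k : Fin N → ℕ) (a : ℕ → Fin N → ℝ), (∀ j, v j = ∑ i, a j i • v (k i)) ∧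
      ∀ i, Tendsto (fun j => a j i) atTop (𝓝 0) := by
  obtain ⟨f, hf, hspan, hli⟩ := Submodule.exists_fun_fin_finrank_span_eq ℝ (range v)
  choose k hk using hf
  have hmem : ∀ j, v j ∈ Submodule.span ℝ (range f) := fun j => by
    rw [hspan]
    exact Submodule.subset_span (mem_range_self j)
  set b := Module.Basis.span hli with hb
  refine ⟨_, k, fun j i => b.repr ⟨v j, hmem j⟩ i, fun j => ?_, fun i => ?_⟩
  · have h := congrArg Subtype.val (b.sum_repr ⟨v j, hmem j⟩)
    simp only [Submodule.coe_sum, Submodule.coe_smul, hb, Module.Basis.span_apply] at h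
    simp only [hk]
    exact h.symm
  · have hc : Continuous (b.coord i) := LinearMap.continuous_of_finiteDimensional _
    have hv' : Tendsto (fun j => (⟨v j, hmem j⟩ : Submodule.span ℝ (range f))) atTop (𝓝 0) :=
      tendsto_subtype_rng.2 hv
    have := (hc.tendsto 0).comp hv'
    rwa [map_zero] at this

/-- The integrals of `f` over an exhausting sequence converge to its extended integral. -/
lemma tendsto_setIntegral_eInt {X : Type*} [MeasurableSpace X] {γ : Measure X} {S : ℕ → Set X}
    (hS : AECover γ atTop S) {f : X → ℝ} (hf : Measurable f)
    (hfS : ∀ j, IntegrableOn f (S j) γ) {c : EReal} (hc : c < eInt γ (fun x => (f x : EReal))) :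
    Tendsto (fun j => ((∫ x in S j, f x ∂γ : ℝ) : EReal)) atTop
      (𝓝 (eInt γ (fun x => (f x : EReal)))) := by
  rw [eInt_coe] at hc ⊢
  simp_rw [coe_integral_eq_lintegral_sub (hfS _)]
  have hP := hS.lintegral_tendsto_of_countably_generated (f := fun x => ENNReal.ofReal (f x))
    (by fun_prop)
  have hN := hS.lintegral_tendsto_of_countably_generated (f := fun x => ENNReal.ofReal (-f x))
    (by fun_prop)
  have hNtop : ∫⁻ x, ENNReal.ofReal (-f x) ∂γ ≠ ⊤ := fun h => by
    simp [h] at hc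
  simp only [sub_eq_add_neg]
  refine (EReal.continuousAt_add (Or.inr ?_) (Or.inl ?_)).tendsto.comp
    (Tendsto.prodMk_nhds ((continuous_coe_ennreal_ereal.tendsto _).comp hP)
      (((continuous_neg.tendsto _).comp (continuous_coe_ennreal_ereal.tendsto _)).comp hN))
  · simpa using hNtop
  · simp

lemma eventually_le_Tcorr_of_lt_eInt {n : ℕ} {μ : Measure (En n)} [IsProbabilityMeasure μ]
    (hμ1 : P1 μ) (hbar : ∫ y, y ∂μ = (0 : En n))
    {ρseq : ℕ → Measure (En n)} (hprob : ∀ k, IsProbabilityMeasure (ρseq k))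
    (hP1 : ∀ k, P1 (ρseq k)) (hcent : ∀ k, ∫ x, x ∂(ρseq k) = (0 : En n))
    {ρ : Measure (En n)} [IsProbabilityMeasure ρ]
    (hweak : ∀ g : BoundedContinuousFunction (En n) ℝ,
      Tendsto (fun k => ∫ x, g x ∂(ρseq k)) atTop (𝓝 (∫ x, g x ∂ρ)))
    {γ : Measure (En n × En n)} (hγ : γ ∈ Plans ρ μ) {c : ℝ}
    (hc : (c : EReal) < eInt γ (fun p => ((⟪p.1, p.2⟫ : ℝ) : EReal))) :
    ∀ᶠ k in atTop, (c : EReal) ≤ Tcorr (ρseq k) μ := by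
  have hγp : IsProbabilityMeasure γ := hγ.1
  have hsnd := hγ.2.2
  have hy : Integrable (fun p : En n × En n => p.2) γ := by
    have := hμ1.integrable_id
    rw [← hsnd] at this
    exact this.comp_measurable measurable_snd
  have hy0 : ∫ p, p.2 ∂γ = (0 : En n) := by
    rw [← hbar, ← hsnd]
    exact (integral_map measurable_snd.aemeasurable aestronglyMeasurable_id).symm
  set S : ℕ → Set (En n × En n) := fun j => {p | ‖p.1‖ ≤ j ∧ ‖p.2‖ ≤ j}
  have hSm : ∀ j, MeasurableSet (S j) := fun j =>
    (measurableSet_le measurable_fst.norm measurable_const).inter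
      (measurableSet_le measurable_snd.norm measurable_const)
  have hSmono : ∀ {i j}, i ≤ j → S i ⊆ S j := fun hij p hp =>
    ⟨hp.1.trans (by exact_mod_cast hij), hp.2.trans (by exact_mod_cast hij)⟩
  have hS : AECover γ atTop S := ⟨ae_of_all _ fun p => by
    filter_upwards [eventually_ge_atTop ⌈max ‖p.1‖ ‖p.2‖⌉₊] with j hj
    exact max_le_iff.1 (Nat.ceil_le.1 hj), hSm⟩
  have hin : ∀ j, IntegrableOn (fun p : En n × En n => (⟪p.1, p.2⟫ : ℝ)) (S j) γ := fun j =>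
    Integrable.of_bound (by fun_prop) ((j : ℝ) * j) ((ae_restrict_iff' (hSm j)).2
      (ae_of_all _ fun p hp => (norm_inner_le_norm _ _).trans
        (mul_le_mul hp.1 hp.2 (norm_nonneg _) (Nat.cast_nonneg _))))
  set J : ℕ → ℝ := fun j => ∫ p in S j, ⟪p.1, p.2⟫ ∂γ
  set v : ℕ → En n := fun j => ∫ p in S j, p.2 ∂γ
  have hv : Tendsto v atTop (𝓝 0) := hy0 ▸ hS.integral_tendsto_of_countably_generated hy
  have hJlim := tendsto_setIntegral_eInt hS (by fun_prop) hin hc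
  obtain ⟨N, k, a, hva, ha⟩ := exists_coeff_tendsto_zero hv
  obtain ⟨c₁, hcc₁, hc₁⟩ := EReal.lt_iff_exists_real_btwn.1 hc
  obtain ⟨c₂, hc₁₂, hc₂⟩ := EReal.lt_iff_exists_real_btwn.1 hc₁
  rw [EReal.coe_lt_coe_iff] at hcc₁ hc₁₂
  obtain ⟨t, ht0, ht1, htc⟩ : ∃ t : ℝ, 0 < t ∧ t < 1 ∧ c < t * c₁ := by
    have h1 : Tendsto (fun t : ℝ => t * c₁) (𝓝[<] 1) (𝓝 (1 * c₁)) :=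
      ((continuous_id.mul continuous_const).tendsto 1).mono_left nhdsWithin_le_nhds
    rw [one_mul] at h1
    obtain ⟨t, h2, h3⟩ := ((h1.eventually (lt_mem_nhds hcc₁)).and
      (Ioo_mem_nhdsLT (zero_lt_one' ℝ))).exists
    exact ⟨t, h3.1, h3.2, h2⟩
  have habs : Tendsto (fun j => ∑ i, |a j i|) atTop (𝓝 0) := by
    simpa using tendsto_finsetSum Finset.univ fun i _ => (ha i).abs
  have hcorr : Tendsto (fun j => ∑ i, a j i * J (k i)) atTop (𝓝 0) := by
    simpa using tendsto_finsetSum Finset.univ fun i _ => (ha i).mul_const (J (k i))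
  obtain ⟨j, hj1, hj2, hj3, hj4⟩ := ((hJlim.eventually (lt_mem_nhds hc₂)).and
    ((habs.eventually (gt_mem_nhds (sub_pos.2 ht1))).and
      ((hcorr.eventually (gt_mem_nhds (sub_pos.2 hc₁₂))).and
        (eventually_all.2 fun i => eventually_ge_atTop (k i))))).exists
  replace hj1 : c₂ < J j := EReal.coe_lt_coe_iff.1 hj1
  set χ : ℕ → En n × En n → ℝ := fun j => (S j).indicator 1 with hχ
  have hχm : ∀ j, Measurable (χ j) := fun j => measurable_one.indicator (hSm j)
  have hχ1 : ∀ j p, |χ j p| ≤ 1 := fun j p => by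
    by_cases hp : p ∈ S j <;> simp [hχ, hp]
  set h : En n × En n → ℝ := fun p => t * (χ j p - ∑ i, a j i * χ (k i) p) with hh
  have hout : ∀ p, p ∉ S j → h p = 0 := fun p hp => by
    have : ∀ i, χ (k i) p = 0 := fun i =>
      indicator_of_notMem (fun hp' => hp (hSmono (hj4 i) hp')) _
    have hj : χ j p = 0 := indicator_of_notMem hp _
    simp [hh, this, hj]
  have hin1 : ∀ p ∈ S j, |1 - (χ j p - ∑ i, a j i * χ (k i) p)| ≤ 1 - t := fun p hp => by
    have h1 : χ j p = 1 := by simp [hχ, hp]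
    rw [h1, sub_sub_cancel]
    refine (Finset.abs_sum_le_sum_abs _ _).trans (le_trans (Finset.sum_le_sum fun i _ => ?_) hj2.le)
    rw [abs_mul]
    exact mul_le_of_le_one_right (abs_nonneg _) (hχ1 _ _)
  have hχsmul : ∀ {F : Type} [NormedAddCommGroup F] [NormedSpace ℝ F] (f : En n × En n → F)
      (i : ℕ), (fun p => χ i p • f p) = (S i).indicator f := fun f i => by
    ext p
    by_cases hp : p ∈ S i <;> simp [hχ, hp]
  have hint : ∀ {F : Type} [NormedAddCommGroup F] [NormedSpace ℝ F] (f : En n × En n → F),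
      (∀ i, IntegrableOn f (S i) γ) → ∫ p, h p • f p ∂γ =
        t • (∫ p in S j, f p ∂γ - ∑ i, a j i • ∫ p in S (k i), f p ∂γ) := fun f hf => by
    have hi : ∀ i, Integrable (fun p => χ i p • f p) γ := fun i => by
      rw [hχsmul]
      exact (integrable_indicator_iff (hSm i)).2 (hf i)
    have hI : ∀ i, ∫ p in S i, f p ∂γ = ∫ p, χ i p • f p ∂γ := fun i => by
      rw [hχsmul, integral_indicator (hSm i)]
    simp_rw [hI, ← integral_smul]
    rw [← integral_finsetSum _ fun i _ => (hi _).fun_smul _, ← integral_sub (hi _)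
      (integrable_finsetSum _ fun i _ => (hi _).fun_smul _), ← integral_smul]
    refine integral_congr_ae (ae_of_all _ fun p => ?_)
    simp only [hh, mul_smul, sub_smul, Finset.sum_smul]
  refine eventually_le_Tcorr_of_cutoff hμ1 hbar hprob hP1 hcent hweak hγ (h := h) (by fun_prop)
    (δ := (1 - t) ^ 2) (by nlinarith) (fun p => ?_) (fun p => ?_) (R := j) (fun p hp => ?_) ?_ ?_
  · by_cases hp : p ∈ S j
    · exact mul_nonneg ht0.le (by linarith [(abs_le.1 (hin1 p hp)).2])
    · exact (hout p hp).ge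
  · by_cases hp : p ∈ S j
    · have := mul_le_mul_of_nonneg_left
        (by linarith [(abs_le.1 (hin1 p hp)).1] :
          χ j p - ∑ i, a j i * χ (k i) p ≤ 2 - t) ht0.le
      simp only [hh]
      linarith
    · rw [hout p hp]
      nlinarith
  · by_contra hlt
    exact hp (hout p fun hp' => hlt hp'.1)
  · rw [hint _ fun i => hy.integrableOn]
    change t • (v j - ∑ i, a j i • v (k i)) = 0
    rw [← hva j, sub_self, smul_zero]
  · have := hint (fun p : En n × En n => (⟪p.1, p.2⟫ : ℝ)) hin
    simp only [smul_eq_mul] at this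
    rw [this]
    change c < t * (J j - ∑ i, a j i * J (k i))
    exact htc.trans (mul_lt_mul_of_pos_left (by linarith) ht0)

/-- Lower semicontinuity of `T(·,μ)` along weakly converging
sequences of centered probability measures. -/
theorem Tcorr_lsc
    (n : ℕ) (μ : Measure (En n)) [IsProbabilityMeasure μ]
    (hμ1 : P1 μ) (hbar : ∫ y, y ∂μ = (0 : En n))
    (ρseq : ℕ → Measure (En n)) (hprob : ∀ k, IsProbabilityMeasure (ρseq k))
    (hP1 : ∀ k, P1 (ρseq k)) (hcent : ∀ k, ∫ x, x ∂(ρseq k) = (0 : En n))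
    (ρ : Measure (En n)) [IsProbabilityMeasure ρ]
    (hweak : ∀ g : BoundedContinuousFunction (En n) ℝ,
      Tendsto (fun k => ∫ x, g x ∂(ρseq k)) atTop (𝓝 (∫ x, g x ∂ρ))) :
    Tcorr ρ μ ≤ liminf (fun k => Tcorr (ρseq k) μ) atTop := by
  refine iSup₂_le fun γ hγ => EReal.ge_of_forall_gt_iff_ge.1 fun c hc => ?_
  exact le_liminf_of_le (by isBoundedDefault)
    (eventually_le_Tcorr_of_lt_eInt hμ1 hbar hprob hP1 hcent hweak hγ hc)

end
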